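/- arXiv:1011.2305 — 5 statements merged into one kernel-verified Lean document; each statement's English description precedes it below -/
import Mathlib

section
/- Let A be an associative unital algebra over ℂ and let X, P be elements of A. Define b⁺ = (X − iP)/√2 and b⁻ = (X + iP)/√2. Then the compatibility conditions [{X,P}, X] = −2iX and [{X,P}, P] = 2iP hold if and only if the osp(1|2) defining relations [{b⁻,b⁺}, b⁺] = 2b⁺ and [{b⁻,b⁺}, b⁻] = −2b⁻ hold. -/
/-- The anticommutator of `b⁻` and `b⁺` is `X² + P²`. -/
theorem anticommutator_ladder_eq {A : Type*} [Ring A] [Algebra ℂ A] (X P : A) (c : ℂ)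
    (hc : c * c = 2⁻¹) :
    (c • (X + Complex.I • P)) * (c • (X - Complex.I • P)) +
      (c • (X - Complex.I • P)) * (c • (X + Complex.I • P)) = X * X + P * P := by
  rw [smul_mul_smul_comm, smul_mul_smul_comm, hc]
  simp only [mul_add, add_mul, mul_sub, sub_mul, smul_mul_assoc, mul_smul_comm]
  match_scalars <;> first | ring1 | linear_combination -Complex.I_mul_I

/-- Two relations for `U ∓ iV` are equivalent to separate relations for `U` and `V`. -/
theorem ladder_relations_iff {A : Type*} [AddCommGroup A] [Module ℂ A] (X P U V : A) :
    ((V = (2 * Complex.I) • X) ∧ (U = (-2 * Complex.I) • P)) ↔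
    ((U - Complex.I • V = (2 : ℂ) • (X - Complex.I • P)) ∧
      (U + Complex.I • V = (-2 : ℂ) • (X + Complex.I • P))) := by
  have hI : Complex.I * Complex.I = -1 := Complex.I_mul_I
  constructor
  · rintro ⟨rfl, rfl⟩
    constructor <;> match_scalars <;>
      first | ring1 | linear_combination (2 : ℂ) * hI | linear_combination (-2 : ℂ) * hI
  · rintro ⟨h₁, h₂⟩
    have hU : U = (-2 * Complex.I) • P := by
      linear_combination (norm := module) (2⁻¹ : ℂ) • h₁ + (2⁻¹ : ℂ) • h₂
    have hV : Complex.I • V = (-2 : ℂ) • X := by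
      linear_combination (norm := module) (2⁻¹ : ℂ) • h₂ - (2⁻¹ : ℂ) • h₁
    refine ⟨?_, hU⟩
    calc V = -(Complex.I • Complex.I • V) := by rw [smul_smul, hI]; module
      _ = (2 * Complex.I) • X := by rw [hV]; module

/-- for `X, P` in an associative unital `ℂ`-algebra, with
`b⁺ = (X − iP)/√2` and `b⁻ = (X + iP)/√2`, the compatibility conditions
`[{X,P}, X] = −2iX` and `[{X,P}, P] = 2iP` hold iff the `osp(1|2)` defining
relations `[{b⁻,b⁺}, b⁺] = 2b⁺` and `[{b⁻,b⁺}, b⁻] = −2b⁻` hold. -/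
theorem wigner_xp_compatibility_iff_osp12
    (A : Type*) [Ring A] [Algebra ℂ A] (X P bp bm : A)
    (hbp : bp = (Real.sqrt 2 : ℂ)⁻¹ • (X - Complex.I • P))
    (hbm : bm = (Real.sqrt 2 : ℂ)⁻¹ • (X + Complex.I • P)) :
    (((X * P + P * X) * X - X * (X * P + P * X) = (-2 * Complex.I) • X) ∧
      ((X * P + P * X) * P - P * (X * P + P * X) = (2 * Complex.I) • P)) ↔
    (((bm * bp + bp * bm) * bp - bp * (bm * bp + bp * bm) = (2 : ℂ) • bp) ∧
      ((bm * bp + bp * bm) * bm - bm * (bm * bp + bp * bm) = (-2 : ℂ) • bm)) := by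
  have hc : ((Real.sqrt 2 : ℂ)⁻¹) * (Real.sqrt 2 : ℂ)⁻¹ = 2⁻¹ := by
    rw [← mul_inv, ← Complex.ofReal_mul, Real.mul_self_sqrt zero_le_two, Complex.ofReal_ofNat]
  have hc0 : (Real.sqrt 2 : ℂ)⁻¹ ≠ 0 := by
    intro h
    norm_num [h] at hc
  have hH : bm * bp + bp * bm = X * X + P * P := by
    rw [hbp, hbm]
    exact anticommutator_ladder_eq X P _ hc
  rw [hH, hbp, hbm]
  simp only [mul_smul_comm, smul_mul_assoc, ← smul_sub, smul_comm _ (Real.sqrt 2 : ℂ)⁻¹,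
    smul_right_inj hc0]
  have key := ladder_relations_iff X P (P * P * X - X * (P * P)) (X * X * P - P * (X * X))
  have e₁ : (X * P + P * X) * X - X * (X * P + P * X) = -(X * X * P - P * (X * X)) := by
    noncomm_ring
  have e₂ : (X * P + P * X) * P - P * (X * P + P * X) = -(P * P * X - X * (P * P)) := by
    noncomm_ring
  have e₃ : (X * X + P * P) * (X - Complex.I • P) - (X - Complex.I • P) * (X * X + P * P) =
      (P * P * X - X * (P * P)) - Complex.I • (X * X * P - P * (X * X)) := by
    simp only [mul_add, add_mul, mul_sub, sub_mul, smul_mul_assoc, mul_smul_comm, smul_sub,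
      smul_add, mul_assoc]
    abel
  have e₄ : (X * X + P * P) * (X + Complex.I • P) - (X + Complex.I • P) * (X * X + P * P) =
      (P * P * X - X * (P * P)) + Complex.I • (X * X * P - P * (X * X)) := by
    simp only [mul_add, add_mul, smul_mul_assoc, mul_smul_comm, smul_sub, smul_add, mul_assoc]
    abel
  rw [e₁, e₂, e₃, e₄, ← key, neg_eq_iff_eq_neg, neg_eq_iff_eq_neg, ← neg_smul, ← neg_smul,
    neg_mul, neg_neg]
end

section
/- Let A be an associative unital algebra over ℂ and let b⁺, b⁻ ∈ A satisfy (i) [{b⁺,b⁻}, b⁺ + b⁻] = 2(b⁺ − b⁻), and (ii) there exist complex scalars c, d with [{b⁺,b⁻}, b⁺] = c·b⁺ + d·b⁻. Assume moreover that the three elements (b⁺)², (b⁻)², {b⁺,b⁻} are linearly independent over ℂ. Then c = 2 and d = 0, and consequently the osp(1|2) defining relations hold: [{b⁻,b⁺}, b⁺] = 2b⁺ and [{b⁻,b⁺}, b⁻] = −2b⁻. -/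
/-- if odd elements `b⁺, b⁻` of an associative unital `ℂ`-algebra satisfy
`[{b⁺,b⁻}, b⁺ + b⁻] = 2(b⁺ − b⁻)` and `[{b⁺,b⁻}, b⁺] = c·b⁺ + d·b⁻` for scalars `c, d`,
and if `(b⁺)², (b⁻)², {b⁺,b⁻}` are linearly independent over `ℂ`, then `c = 2`, `d = 0`
and the `osp(1|2)` defining relations hold. -/
theorem free_particle_generates_osp12
    (A : Type*) [Ring A] [Algebra ℂ A] (bp bm : A) (c d : ℂ)
    (h1 : (bp * bm + bm * bp) * (bp + bm) - (bp + bm) * (bp * bm + bm * bp)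
        = (2 : ℂ) • (bp - bm))
    (h2 : (bp * bm + bm * bp) * bp - bp * (bp * bm + bm * bp) = c • bp + d • bm)
    (hli : LinearIndependent ℂ ![bp * bp, bm * bm, bp * bm + bm * bp]) :
    c = 2 ∧ d = 0 ∧
    ((bm * bp + bp * bm) * bp - bp * (bm * bp + bp * bm) = (2 : ℂ) • bp) ∧
    ((bm * bp + bp * bm) * bm - bm * (bm * bp + bp * bm) = (-2 : ℂ) • bm) := by
  have h3 : (bp * bm + bm * bp) * bm - bm * (bp * bm + bm * bp)
      = (2 - c) • bp + (-2 - d) • bm := by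
    calc (bp * bm + bm * bp) * bm - bm * (bp * bm + bm * bp)
        = ((bp * bm + bm * bp) * (bp + bm) - (bp + bm) * (bp * bm + bm * bp))
          - ((bp * bm + bm * bp) * bp - bp * (bp * bm + bm * bp)) := by noncomm_ring
      _ = (2 - c) • bp + (-2 - d) • bm := by rw [h1, h2]; module
  have leibniz : (c • bp + d • bm) * bm + bm * (c • bp + d • bm)
      + (bp * ((2 - c) • bp + (-2 - d) • bm) + ((2 - c) • bp + (-2 - d) • bm) * bp) = 0 := by
    rw [← h2, ← h3]
    noncomm_ring
  have relation : (2 * (2 - c)) • (bp * bp) + (2 * d) • (bm * bm)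
      + (c - 2 - d) • (bp * bm + bm * bp) = 0 := by
    rw [← leibniz]
    simp only [mul_add, add_mul, smul_mul_assoc, mul_smul_comm]
    module
  have coeffs := Fintype.linearIndependent_iff.mp hli ![2 * (2 - c), 2 * d, c - 2 - d]
    (by simpa [Fin.sum_univ_three] using relation)
  have hc : c = 2 := by
    have h := coeffs 0
    simp only [Matrix.cons_val_zero] at h
    linear_combination (-1 / 2) * h
  have hd : d = 0 := by
    have h := coeffs 1
    simp only [Matrix.cons_val_one, Matrix.cons_val_zero] at h
    linear_combination (1 / 2) * h
  subst hc hd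
  rw [add_comm (bm * bp)]
  exact ⟨rfl, rfl, by simpa using h2, by simpa using h3⟩
end

section
/- Let a > 0 be real. Let B⁺ and B⁻ be the ℂ-linear operators on the space of finitely supported functions ℕ → ℂ defined on the standard basis (e_k)_{k≥0} by B⁺e_{2n} = √(2(n+a))·e_{2n+1}, B⁺e_{2n+1} = √(2(n+1))·e_{2n+2}, B⁻e_{2n} = √(2n)·e_{2n−1} (so B⁻e_0 = 0), and B⁻e_{2n+1} = √(2(n+a))·e_{2n}. Then B⁺ and B⁻ satisfy the osp(1|2) defining relations [{B⁻,B⁺}, B⁺] = 2B⁺ and [{B⁻,B⁺}, B⁻] = −2B⁻, and the operator h = ½{B⁺,B⁻} satisfies h·e_0 = a·e_0. -/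
/-- If `H` is diagonal in the standard basis with eigenvalues `c k`, and `B` sends each `e_k` into
an eigenspace of eigenvalue `c k + d`, then `[H, B] = d B`. -/
lemma commutator_eq_smul_of_shift (H B : (ℕ →₀ ℂ) →ₗ[ℂ] (ℕ →₀ ℂ)) (c : ℕ → ℂ) (d : ℂ)
    (hH : ∀ k, H (Finsupp.single k 1) = c k • Finsupp.single k 1)
    (hB : ∀ k, H (B (Finsupp.single k 1)) = (c k + d) • B (Finsupp.single k 1)) :
    H ∘ₗ B - B ∘ₗ H = d • B := by
  refine Finsupp.basisSingleOne.ext fun k => ?_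
  simp only [Finsupp.coe_basisSingleOne, LinearMap.sub_apply, LinearMap.comp_apply,
    LinearMap.smul_apply, hB, hH, map_smul]
  module

lemma ofReal_sqrt_mul_self {x : ℝ} (hx : 0 ≤ x) :
    (Real.sqrt x : ℂ) * (Real.sqrt x : ℂ) = (x : ℂ) := by
  rw [← Complex.ofReal_mul, Real.mul_self_sqrt hx]

/-- the operators `B⁺, B⁻` of the positive discrete series representation
with lowest weight `a > 0`, acting on finitely supported functions `ℕ → ℂ` via the
standard basis `e_k = Finsupp.single k 1`, satisfy the `osp(1|2)` defining relations
`[{B⁻,B⁺}, B⁺] = 2B⁺` and `[{B⁻,B⁺}, B⁻] = −2B⁻`, and `h = ½{B⁺,B⁻}` satisfies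
`h e₀ = a e₀`. -/
theorem osp12_discrete_series_relations (a : ℝ) (ha : 0 < a)
    (Bp Bm : (ℕ →₀ ℂ) →ₗ[ℂ] (ℕ →₀ ℂ))
    (hp0 : ∀ n : ℕ, Bp (Finsupp.single (2 * n) 1)
        = (Real.sqrt (2 * ((n : ℝ) + a)) : ℂ) • Finsupp.single (2 * n + 1) 1)
    (hp1 : ∀ n : ℕ, Bp (Finsupp.single (2 * n + 1) 1)
        = (Real.sqrt (2 * ((n : ℝ) + 1)) : ℂ) • Finsupp.single (2 * n + 2) 1)
    (hm0 : Bm (Finsupp.single 0 1) = 0)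
    (hm1 : ∀ n : ℕ, Bm (Finsupp.single (2 * (n + 1)) 1)
        = (Real.sqrt (2 * ((n : ℝ) + 1)) : ℂ) • Finsupp.single (2 * n + 1) 1)
    (hm2 : ∀ n : ℕ, Bm (Finsupp.single (2 * n + 1) 1)
        = (Real.sqrt (2 * ((n : ℝ) + a)) : ℂ) • Finsupp.single (2 * n) 1) :
    ((Bm ∘ₗ Bp + Bp ∘ₗ Bm) ∘ₗ Bp - Bp ∘ₗ (Bm ∘ₗ Bp + Bp ∘ₗ Bm) = (2 : ℂ) • Bp) ∧
    ((Bm ∘ₗ Bp + Bp ∘ₗ Bm) ∘ₗ Bm - Bm ∘ₗ (Bm ∘ₗ Bp + Bp ∘ₗ Bm) = (-2 : ℂ) • Bm) ∧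
    (((1 / 2 : ℂ) • (Bp ∘ₗ Bm + Bm ∘ₗ Bp)) (Finsupp.single 0 1)
        = (a : ℂ) • Finsupp.single 0 1) := by
  have sa (n : ℕ) := ofReal_sqrt_mul_self (x := 2 * ((n : ℝ) + a)) (by positivity)
  have s1 (n : ℕ) := ofReal_sqrt_mul_self (x := 2 * ((n : ℝ) + 1)) (by positivity)
  have hH (k : ℕ) : (Bm ∘ₗ Bp + Bp ∘ₗ Bm) (Finsupp.single k 1)
      = (2 * (k : ℂ) + 2 * a) • Finsupp.single k 1 := by
    simp only [LinearMap.add_apply, LinearMap.comp_apply]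
    obtain ⟨n, rfl | rfl⟩ := k.even_or_odd'
    · rw [hp0, map_smul, hm2, smul_smul, sa]
      cases n with
      | zero => simp [hm0]
      | succ n =>
        rw [hm1, map_smul, hp1, smul_smul, s1, show 2 * n + 2 = 2 * (n + 1) from rfl, ← add_smul]
        congr 1
        push_cast
        ring
    · rw [hp1, map_smul, show 2 * n + 2 = 2 * (n + 1) from rfl, hm1, smul_smul, s1, hm2,
        map_smul, hp0, smul_smul, sa, ← add_smul]
      congr 1
      push_cast
      ring
  refine ⟨commutator_eq_smul_of_shift _ _ _ _ hH fun k => ?_,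
    commutator_eq_smul_of_shift _ _ _ _ hH fun k => ?_, ?_⟩
  · obtain ⟨n, rfl | rfl⟩ := k.even_or_odd'
    · rw [hp0, map_smul, hH]
      push_cast
      module
    · rw [hp1, map_smul, hH]
      push_cast
      module
  · obtain ⟨n, rfl | rfl⟩ := k.even_or_odd'
    · cases n with
      | zero => simp [hm0]
      | succ n =>
        rw [hm1, map_smul, hH]
        push_cast
        module
    · rw [hm2, map_smul, hH]
      push_cast
      module
  · rw [add_comm, LinearMap.smul_apply, hH]
    push_cast
    module
end

section
/- Let a > 0 and x ∈ ℝ. The coefficients β_n(x) of the formal eigenvector of the position operator x̂ satisfy, for all n ≥ 0 (with the convention β_{−1} = 0), the coupled pair of recurrence relations x·β_{2n}(x) = √n·β_{2n−1}(x) + √(n+a)·β_{2n+1}(x) and x·β_{2n+1}(x) = √(n+a)·β_{2n}(x) + √(n+1)·β_{2n+2}(x). -/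
/-- Pochhammer symbol `(c)_k` in `ℂ`. -/
noncomputable def pochC (c : ℂ) (k : ℕ) : ℂ := ∏ j ∈ Finset.range k, (c + j)

/-- Pochhammer symbol `(c)_k` in `ℝ`. -/
noncomputable def pochR (c : ℝ) (k : ℕ) : ℝ := ∏ j ∈ Finset.range k, (c + j)

/-- The prefactor `ℬ₀(x) = |x|^{a−1/2}·e^{−x²/2}/√Γ(a)`. -/
noncomputable def calB0 (a x : ℝ) : ℝ :=
  |x| ^ (a - 1 / 2) * Real.exp (-x ^ 2 / 2) / Real.sqrt (Real.Gamma a)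

/-- The prefactor `ℬ₁(x) = x·|x|^{a−1/2}·e^{−x²/2}/√Γ(a+1)`. -/
noncomputable def calB1 (a x : ℝ) : ℝ :=
  x * |x| ^ (a - 1 / 2) * Real.exp (-x ^ 2 / 2) / Real.sqrt (Real.Gamma (a + 1))

/-- The coefficient `β_{2n}(x) = (−1)ⁿ √((a)_n/n!) ℬ₀(x) ₁F₁(−n; a; x²)`,
a normalized generalized Hermite function. -/
noncomputable def betaEv (a x : ℝ) (n : ℕ) : ℂ :=
  (-1) ^ n * (Real.sqrt (pochR a n / n.factorial) : ℂ) * (calB0 a x : ℂ) *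
    ∑ k ∈ Finset.range (n + 1),
      pochC (-(n : ℂ)) k / (pochC (a : ℂ) k * (k.factorial : ℂ)) * (x : ℂ) ^ (2 * k)

/-- The coefficient `β_{2n+1}(x) = (−1)ⁿ √((a+1)_n/n!) ℬ₁(x) ₁F₁(−n; a+1; x²)`,
a normalized generalized Hermite function. -/
noncomputable def betaOdd (a x : ℝ) (n : ℕ) : ℂ :=
  (-1) ^ n * (Real.sqrt (pochR (a + 1) n / n.factorial) : ℂ) * (calB1 a x : ℂ) *
    ∑ k ∈ Finset.range (n + 1),
      pochC (-(n : ℂ)) k / (pochC ((a : ℂ) + 1) k * (k.factorial : ℂ)) * (x : ℂ) ^ (2 * k)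

/-- The full family `β_m(x)`, combining even and odd indices. -/
noncomputable def betaFn (a x : ℝ) (m : ℕ) : ℂ :=
  if Even m then betaEv a x (m / 2) else betaOdd a x (m / 2)

theorem pochC_zero (c : ℂ) : pochC c 0 = 1 :=
  Finset.prod_range_zero _

theorem pochC_succ (c : ℂ) (k : ℕ) : pochC c (k + 1) = pochC c k * (c + k) :=
  Finset.prod_range_succ _ _

theorem pochC_succ_left (c : ℂ) (k : ℕ) : pochC c (k + 1) = c * pochC (c + 1) k := by
  unfold pochC
  rw [Finset.prod_range_succ']
  simp only [Nat.cast_zero, add_zero]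
  rw [mul_comm]
  congr 1
  refine Finset.prod_congr rfl fun j _ => ?_
  push_cast
  ring

theorem pochC_neg_natCast_succ (n : ℕ) : pochC (-(n : ℂ)) (n + 1) = 0 := by
  rw [pochC_succ, neg_add_cancel, mul_zero]

theorem pochC_ofReal_ne_zero {a : ℝ} (ha : 0 < a) (k : ℕ) : pochC (a : ℂ) k ≠ 0 := by
  refine Finset.prod_ne_zero_iff.mpr fun j _ => ?_
  have : a + (j : ℝ) ≠ 0 := by positivity
  exact_mod_cast this

theorem pochR_succ (c : ℝ) (k : ℕ) : pochR c (k + 1) = pochR c k * (c + k) :=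
  Finset.prod_range_succ _ _

theorem mul_pochR_add_one (c : ℝ) (k : ℕ) :
    c * pochR (c + 1) k = pochR c k * (c + k) := by
  rw [← pochR_succ]
  unfold pochR
  rw [Finset.prod_range_succ']
  simp only [Nat.cast_zero, add_zero]
  rw [mul_comm]
  congr 1
  refine Finset.prod_congr rfl fun j _ => ?_
  push_cast
  ring

theorem pochR_pos {a : ℝ} (ha : 0 < a) (k : ℕ) : 0 < pochR a k :=
  Finset.prod_pos fun j _ => by positivity

/-- The terminating confluent hypergeometric series `₁F₁(−n; c; x²)`. -/
noncomputable def kummerSum (n : ℕ) (c x : ℂ) : ℂ :=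
  ∑ k ∈ Finset.range (n + 1),
    pochC (-(n : ℂ)) k / (pochC c k * (k.factorial : ℂ)) * x ^ (2 * k)

theorem kummerSum_eq_sum_range_add_two (n : ℕ) (c x : ℂ) :
    kummerSum n c x = ∑ k ∈ Finset.range (n + 2),
      pochC (-(n : ℂ)) k / (pochC c k * (k.factorial : ℂ)) * x ^ (2 * k) := by
  rw [Finset.sum_range_succ _ (n + 1), pochC_neg_natCast_succ]
  simp [kummerSum]

theorem kummerSum_zero (c x : ℂ) : kummerSum 0 c x = 1 := by
  simp [kummerSum, pochC_zero]

theorem mul_kummerSum_succ {a : ℝ} (ha : 0 < a) (x : ℂ) (n : ℕ) :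
    a * kummerSum (n + 1) a x =
      (n + 1 + a) * kummerSum (n + 1) (a + 1) x - (n + 1) * kummerSum n (a + 1) x := by
  rw [kummerSum_eq_sum_range_add_two n]
  unfold kummerSum
  rw [Finset.mul_sum, Finset.mul_sum, Finset.mul_sum, ← Finset.sum_sub_distrib]
  refine Finset.sum_congr rfl fun k _ => ?_
  have h1 : pochC (a : ℂ) k ≠ 0 := pochC_ofReal_ne_zero ha k
  have h2 : pochC ((a : ℂ) + 1) k ≠ 0 := by
    exact_mod_cast pochC_ofReal_ne_zero (a := a + 1) (by positivity) k
  have h3 : (k.factorial : ℂ) ≠ 0 := by exact_mod_cast k.factorial_ne_zero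
  have ea : pochC (a : ℂ) k * (a + k) = a * pochC (a + 1) k := by
    rw [← pochC_succ, pochC_succ_left]
  have en : pochC (-((n + 1 : ℕ) : ℂ)) k * (-((n + 1 : ℕ) : ℂ) + k) =
      -((n + 1 : ℕ) : ℂ) * pochC (-(n : ℂ)) k := by
    rw [← pochC_succ, pochC_succ_left]
    congr 2
    push_cast
    ring
  generalize pochC (-((n + 1 : ℕ) : ℂ)) k = p at *
  push_cast at en
  field_simp
  linear_combination x ^ (2 * k) * (pochC (a : ℂ) k * en - p * ea)

theorem sq_mul_kummerSum_add_one {a : ℝ} (ha : 0 < a) (x : ℂ) (n : ℕ) :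
    x ^ 2 * kummerSum n (a + 1) x = a * (kummerSum n a x - kummerSum (n + 1) a x) := by
  rw [kummerSum_eq_sum_range_add_two n (a : ℂ)]
  unfold kummerSum
  rw [← Finset.sum_sub_distrib, Finset.sum_range_succ' _ (n + 1), mul_add, Finset.mul_sum,
    Finset.mul_sum]
  simp only [pochC_zero, sub_self, mul_zero, add_zero]
  refine Finset.sum_congr rfl fun k _ => ?_
  have h0 : (a : ℂ) ≠ 0 := by exact_mod_cast ha.ne'
  have h2 : pochC ((a : ℂ) + 1) k ≠ 0 := by
    exact_mod_cast pochC_ofReal_ne_zero (a := a + 1) (by positivity) k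
  have h3 : (k.factorial : ℂ) ≠ 0 := by exact_mod_cast k.factorial_ne_zero
  have h4 : (k : ℂ) + 1 ≠ 0 := by exact_mod_cast k.succ_ne_zero
  have en : -((n + 1 : ℕ) : ℂ) + 1 = -(n : ℂ) := by push_cast; ring
  rw [pochC_succ_left (a : ℂ), pochC_succ_left (-((n + 1 : ℕ) : ℂ)), en, pochC_succ,
    Nat.factorial_succ]
  push_cast
  field_simp
  ring

theorem calB1_eq {a : ℝ} (ha : 0 < a) (x : ℝ) : calB1 a x = x * calB0 a x / √a := by
  unfold calB1 calB0
  rw [Real.Gamma_add_one ha.ne', Real.sqrt_mul ha.le]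
  have := Real.sqrt_pos.mpr (Real.Gamma_pos_of_pos ha)
  have := Real.sqrt_pos.mpr ha
  field_simp

theorem sqrt_pochR_add_one_div_factorial {a : ℝ} (ha : 0 < a) (n : ℕ) :
    √(pochR (a + 1) n / n.factorial) = √(pochR a n / n.factorial) * √(n + a) / √a := by
  rw [← Real.sqrt_mul (div_nonneg (pochR_pos ha n).le (by positivity)),
    ← Real.sqrt_div' _ ha.le]
  congr 1
  field_simp
  linear_combination mul_pochR_add_one a n

theorem sqrt_pochR_succ_div_factorial {a : ℝ} (ha : 0 < a) (n : ℕ) :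
    √(pochR a (n + 1) / (n + 1).factorial) =
      √(pochR a n / n.factorial) * √(n + a) / √(n + 1) := by
  rw [← Real.sqrt_mul (div_nonneg (pochR_pos ha n).le (by positivity)),
    ← Real.sqrt_div' _ (by positivity), pochR_succ, Nat.factorial_succ]
  congr 1
  push_cast
  field_simp
  ring

theorem ofReal_sqrt_sq {r : ℝ} (hr : 0 ≤ r) : ((√r : ℝ) : ℂ) ^ 2 = r := by
  exact_mod_cast Real.sq_sqrt hr

theorem betaEv_eq (a x : ℝ) (n : ℕ) :
    betaEv a x n = (-1) ^ n * (√(pochR a n / n.factorial) : ℝ) * (calB0 a x : ℂ) *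
      kummerSum n a x := rfl

theorem betaOdd_eq {a : ℝ} (ha : 0 < a) (x : ℝ) (n : ℕ) :
    betaOdd a x n = (-1) ^ n * (√(pochR a n / n.factorial) : ℝ) * (calB0 a x : ℂ) *
      ((√(n + a) : ℝ) * x / a * kummerSum n (a + 1) x) := by
  have hs := ofReal_sqrt_sq ha.le
  have h0 : ((√a : ℝ) : ℂ) ≠ 0 := by exact_mod_cast (Real.sqrt_pos.mpr ha).ne'
  unfold betaOdd
  rw [← kummerSum, sqrt_pochR_add_one_div_factorial ha, calB1_eq ha]
  generalize kummerSum n ((a : ℂ) + 1) x = K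
  rw [← hs]
  push_cast
  field_simp

theorem betaEv_succ {a : ℝ} (ha : 0 < a) (x : ℝ) (n : ℕ) :
    betaEv a x (n + 1) = -((-1) ^ n * (√(pochR a n / n.factorial) : ℝ) * (calB0 a x : ℂ) *
      ((√(n + a) : ℝ) / (√(n + 1) : ℝ) * kummerSum (n + 1) a x)) := by
  rw [betaEv_eq, sqrt_pochR_succ_div_factorial ha]
  push_cast
  ring

theorem betaFn_two_mul (a x : ℝ) (n : ℕ) : betaFn a x (2 * n) = betaEv a x n := by
  simp [betaFn]

theorem betaFn_two_mul_add_one (a x : ℝ) (n : ℕ) :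
    betaFn a x (2 * n + 1) = betaOdd a x n := by
  have h : (2 * n + 1) / 2 = n := by omega
  simp [betaFn, h]

theorem mul_betaEv_zero {a : ℝ} (ha : 0 < a) (x : ℝ) :
    x * betaEv a x 0 = (√a : ℝ) * betaOdd a x 0 := by
  have hs := ofReal_sqrt_sq ha.le
  have h0 : (a : ℂ) ≠ 0 := by exact_mod_cast ha.ne'
  rw [betaOdd_eq ha, betaEv_eq, kummerSum_zero, kummerSum_zero]
  simp only [Nat.cast_zero, zero_add]
  field_simp
  rw [hs]

theorem mul_betaEv_succ {a : ℝ} (ha : 0 < a) (x : ℝ) (n : ℕ) :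
    x * betaEv a x (n + 1) =
      (√(n + 1) : ℝ) * betaOdd a x n + (√(n + 1 + a) : ℝ) * betaOdd a x (n + 1) := by
  have hs := ofReal_sqrt_sq (r := n + 1 + a) (by positivity)
  have ht := ofReal_sqrt_sq (r := (n : ℝ) + 1) (by positivity)
  have h0 : (a : ℂ) ≠ 0 := by exact_mod_cast ha.ne'
  have h1 : ((√(n + 1) : ℝ) : ℂ) ≠ 0 := by
    exact_mod_cast (Real.sqrt_pos.mpr (by positivity : (0 : ℝ) < n + 1)).ne'
  have hk := mul_kummerSum_succ ha x n
  rw [betaEv_succ ha, betaOdd_eq ha, betaOdd_eq ha, sqrt_pochR_succ_div_factorial ha]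
  push_cast at hs ht ⊢
  field_simp
  rw [hs, ht, pow_succ]
  linear_combination
    -((-1) ^ n * x * (√(pochR a n / n.factorial) : ℝ) * calB0 a x * (√(n + a) : ℝ)) * hk

theorem mul_betaOdd {a : ℝ} (ha : 0 < a) (x : ℝ) (n : ℕ) :
    x * betaOdd a x n =
      (√(n + a) : ℝ) * betaEv a x n + (√(n + 1) : ℝ) * betaEv a x (n + 1) := by
  have h0 : (a : ℂ) ≠ 0 := by exact_mod_cast ha.ne'
  have h1 : ((√(n + 1) : ℝ) : ℂ) ≠ 0 := by
    exact_mod_cast (Real.sqrt_pos.mpr (by positivity : (0 : ℝ) < n + 1)).ne'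
  have hk := sq_mul_kummerSum_add_one ha x n
  rw [betaEv_succ ha, betaOdd_eq ha, betaEv_eq]
  field_simp
  linear_combination
    (√(pochR a n / n.factorial) : ℝ) * calB0 a x * (√(n + a) : ℝ) * hk

/-- the coefficients `β_n(x)` of the formal eigenvector of the position
operator `x̂` satisfy, with the convention `β_{−1} = 0`, the coupled recurrences
`x·β_{2n} = √n·β_{2n−1} + √(n+a)·β_{2n+1}` and
`x·β_{2n+1} = √(n+a)·β_{2n} + √(n+1)·β_{2n+2}`. -/
theorem betaFn_recurrence (a x : ℝ) (ha : 0 < a) (n : ℕ) :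
    ((x : ℂ) * betaFn a x (2 * n) =
        (Real.sqrt (n : ℝ) : ℂ) * (if n = 0 then 0 else betaFn a x (2 * n - 1))
          + (Real.sqrt ((n : ℝ) + a) : ℂ) * betaFn a x (2 * n + 1)) ∧
    ((x : ℂ) * betaFn a x (2 * n + 1) =
        (Real.sqrt ((n : ℝ) + a) : ℂ) * betaFn a x (2 * n)
          + (Real.sqrt ((n : ℝ) + 1) : ℂ) * betaFn a x (2 * n + 2)) := by
  refine ⟨?_, ?_⟩
  · rw [betaFn_two_mul, betaFn_two_mul_add_one]
    cases n with
    | zero => simpa using mul_betaEv_zero ha x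
    | succ m =>
      rw [if_neg m.succ_ne_zero, show 2 * (m + 1) - 1 = 2 * m + 1 by omega,
        betaFn_two_mul_add_one]
      simpa using mul_betaEv_succ ha x m
  · rw [betaFn_two_mul, betaFn_two_mul_add_one, show 2 * n + 2 = 2 * (n + 1) by ring,
      betaFn_two_mul]
    exact mul_betaOdd ha x n
end

section
/- Let a > 0, E > 0 and x ∈ ℝ with x ≠ 0. Then the Abel limit of the overlap series between the position eigenvector and the odd free-particle energy eigenvector exists and equals lim_{t→1⁻} Σ_{n=0}^{∞} β_{2n+1}(x)·ε_{2n+1}(E)·tⁿ = (1/(2^{(a+1)/2}·Γ(a+1))) · x·|x|^{a−1/2} · E^{a/2} · ₀F₁(−; a+1; −E·x²/2). -/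
/-- The prefactor `ℰ₁(E) = E^{a/2}·e^{−E}·√(2^{a+1})/√Γ(a+1)`. -/
noncomputable def calE1 (a E : ℝ) : ℝ :=
  E ^ (a / 2) * Real.exp (-E) * Real.sqrt ((2 : ℝ) ^ (a + 1)) / Real.sqrt (Real.Gamma (a + 1))

/-- The coefficient `ε_{2n+1}(E) = √((a+1)_n/n!)·ℰ₁(E)·₁F₁(−n; a+1; 2E)`. -/
noncomputable def epsOdd (a E : ℝ) (n : ℕ) : ℝ :=
  Real.sqrt (pochR (a + 1) n / n.factorial) * calE1 a E *
    ∑ k ∈ Finset.range (n + 1),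
      pochR (-(n : ℝ)) k / (pochR (a + 1) k * k.factorial) * (2 * E) ^ k

/-- The confluent hypergeometric limit function `₀F₁(−; c; z) = Σ z^k/((c)_k·k!)`. -/
noncomputable def hyp0F1 (c z : ℂ) : ℂ := ∑' k : ℕ, z ^ k / (pochC c k * (k.factorial : ℂ))

/-- The weight `(c)_n / n!` of the `n`-th Laguerre function. -/
noncomputable def laguerreWeight (c : ℝ) (n : ℕ) : ℝ := pochR c n / n.factorial

/-- The normalized Laguerre polynomial `₁F₁(−n; c; x)`. -/
noncomputable def laguerreNormalized (c : ℝ) (n : ℕ) (x : ℝ) : ℝ :=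
  ∑ k ∈ Finset.range (n + 1), (n.choose k : ℝ) * (-x) ^ k / pochR c k

/-- The real confluent hypergeometric limit function `₀F₁(−; c; u)`. -/
noncomputable def realHyp0F1 (c u : ℝ) : ℝ := ∑' k : ℕ, u ^ k / (pochR c k * k.factorial)

lemma pochR_pos_s16 {c : ℝ} (hc : 0 < c) (k : ℕ) : 0 < pochR c k :=
  Finset.prod_pos fun j _ => by positivity

lemma pochR_add (c : ℝ) (k m : ℕ) : pochR c (k + m) = pochR c k * pochR (c + k) m := by
  unfold pochR
  rw [Finset.prod_range_add]
  congr 1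
  exact Finset.prod_congr rfl fun j _ => by push_cast; ring

lemma pochR_neg_natCast (n k : ℕ) :
    pochR (-(n : ℝ)) k = (-1) ^ k * (k.factorial * n.choose k) := by
  rw [← Nat.cast_mul, ← Nat.descFactorial_eq_factorial_mul_choose]
  unfold pochR
  induction k with
  | zero => simp
  | succ k ih =>
    rw [Finset.prod_range_succ, ih, Nat.descFactorial_succ]
    rcases le_or_gt k n with h | h
    · push_cast [h]; ring
    · rw [Nat.descFactorial_eq_zero_iff_lt.2 h]; simp

lemma ofReal_pochR (c : ℝ) (k : ℕ) : ((pochR c k : ℝ) : ℂ) = pochC c k := by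
  simp [pochR, pochC]

lemma laguerreWeight_pos {c : ℝ} (hc : 0 < c) (n : ℕ) : 0 < laguerreWeight c n :=
  div_pos (pochR_pos_s16 hc n) (by positivity)

lemma laguerreNormalized_eq (c : ℝ) (n : ℕ) (x : ℝ) :
    laguerreNormalized c n x =
      ∑ k ∈ Finset.range (n + 1), pochR (-(n : ℝ)) k / (pochR c k * k.factorial) * x ^ k := by
  refine Finset.sum_congr rfl fun k _ => ?_
  have : (k.factorial : ℝ) ≠ 0 := by positivity
  rw [pochR_neg_natCast, neg_pow x]
  field_simp

lemma laguerreNormalized_nonneg {c : ℝ} (hc : 0 < c) (n : ℕ) {x : ℝ} (hx : x ≤ 0) :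
    0 ≤ laguerreNormalized c n x :=
  Finset.sum_nonneg fun k _ =>
    div_nonneg (mul_nonneg (by positivity) (pow_nonneg (by linarith) k)) (pochR_pos_s16 hc k).le

lemma abs_laguerreNormalized_le {c : ℝ} (hc : 0 < c) (n : ℕ) (x : ℝ) :
    |laguerreNormalized c n x| ≤ laguerreNormalized c n (-|x|) := by
  refine (Finset.abs_sum_le_sum_abs _ _).trans (le_of_eq ?_)
  refine Finset.sum_congr rfl fun k _ => ?_
  rw [abs_div, abs_mul, abs_pow, abs_neg, neg_neg, abs_of_pos (pochR_pos_s16 hc k), Nat.abs_cast]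

lemma hasSum_of_eq {f g : ℕ → ℝ} {a b : ℝ} (h : HasSum f a) (hf : ∀ n, f n = g n) (ha : a = b) :
    HasSum g b := by
  rw [← ha, ← funext hf]
  exact h

/-- Fubini for a double series with dominated rows. -/
lemma hasSum_swap_of_dominated {f g : ℕ → ℕ → ℝ} {A B : ℕ → ℝ} {S : ℝ}
    (hfg : ∀ k n, |f k n| ≤ g k n) (hg : ∀ k, HasSum (g k) (A k)) (hA : Summable A)
    (hB : ∀ k, HasSum (f k) (B k)) (hS : HasSum B S) :
    (∀ n, Summable fun k => f k n) ∧ HasSum (fun n => ∑' k, f k n) S := by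
  have hg' : Summable fun p : ℕ × ℕ => g p.1 p.2 := by
    refine (summable_prod_of_nonneg fun p => (abs_nonneg _).trans (hfg p.1 p.2)).2
      ⟨fun k => (hg k).summable, ?_⟩
    simpa only [fun k => (hg k).tsum_eq] using hA
  have hf : Summable fun p : ℕ × ℕ => f p.1 p.2 :=
    hg'.of_norm_bounded fun p => by simpa using hfg p.1 p.2
  have hf' : Summable fun p : ℕ × ℕ => f p.2 p.1 := hf.prod_symm
  have hsum : ∑' p : ℕ × ℕ, f p.1 p.2 = S :=
    (hf.hasSum.prod_fiberwise hB).unique hS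
  have hrow : ∀ n, Summable fun k => f k n := fun n => hf'.prod_factor n
  refine ⟨hrow, ?_⟩
  have h := hf'.hasSum.prod_fiberwise fun n => (hrow n).hasSum
  rwa [← (Equiv.prodComm ℕ ℕ).tsum_eq, show (∑' p : ℕ × ℕ, f ((Equiv.prodComm ℕ ℕ) p).2
    ((Equiv.prodComm ℕ ℕ) p).1) = S from hsum] at h

lemma hasSum_laguerreWeight_mul_pow (c : ℝ) {s : ℝ} (hs : |s| < 1) :
    HasSum (fun n => laguerreWeight c n * s ^ n) (1 / (1 - s) ^ c) := by
  have h := (Real.one_div_one_sub_rpow_hasFPowerSeriesOnBall_zero c).hasSum (y := s)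
    (by simpa [enorm_eq_nnnorm] using! hs)
  simp only [zero_add] at h
  refine hasSum_of_eq h (fun n => ?_) rfl
  have h1 := Ring.factorial_nsmul_multichoose_eq_ascPochhammer c n
  rw [Ring.multichoose_eq, Polynomial.ascPochhammer_smeval_eq_eval] at h1
  have h2 : (ascPochhammer ℝ n).eval c = pochR c n := by
    unfold pochR
    clear h1 h
    induction n with
    | zero => simp
    | succ n ih => rw [ascPochhammer_succ_eval, Finset.prod_range_succ, ih]
  rw [h2, nsmul_eq_mul] at h1
  have h3 : (n.factorial : ℝ) ≠ 0 := by positivity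
  simp [FormalMultilinearSeries.ofScalars, laguerreWeight, ← h1, h3]

lemma laguerreWeight_add_mul_choose (c : ℝ) (k m : ℕ) :
    laguerreWeight c (m + k) * ((m + k).choose k : ℝ) =
      laguerreWeight c k * laguerreWeight (c + k) m := by
  have h := Nat.add_choose_mul_factorial_mul_factorial m k
  have h' : ((m + k).choose k : ℝ) * m.factorial * k.factorial = (m + k).factorial := by
    exact_mod_cast h
  unfold laguerreWeight
  have h1 : (m.factorial : ℝ) ≠ 0 := by positivity
  have h2 : (k.factorial : ℝ) ≠ 0 := by positivity
  have h3 : ((m + k).choose k : ℝ) ≠ 0 := by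
    exact_mod_cast (Nat.choose_pos (Nat.le_add_left k m)).ne'
  rw [← h', add_comm m k, pochR_add]
  rw [add_comm m k] at h3
  field_simp

lemma hasSum_laguerreWeight_mul_choose_mul_pow (c : ℝ) (k : ℕ) {s : ℝ} (hs : |s| < 1) :
    HasSum (fun n => laguerreWeight c n * (n.choose k : ℝ) * s ^ n)
      (laguerreWeight c k * (s / (1 - s)) ^ k * (1 / (1 - s) ^ c)) := by
  have hs1 : 0 < 1 - s := by linarith [(abs_lt.1 hs).2]
  have h := (hasSum_laguerreWeight_mul_pow (c + k) hs).mul_left (laguerreWeight c k * s ^ k)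
  have hinj : Function.Injective fun m : ℕ => m + k := add_left_injective k
  rw [← hinj.hasSum_iff]
  · refine hasSum_of_eq h (fun m => ?_) ?_
    · simp only [Function.comp_apply]
      rw [laguerreWeight_add_mul_choose, pow_add]; ring
    · rw [Real.rpow_add hs1, Real.rpow_natCast, div_pow]; field_simp
  · intro n hn
    have : n < k := by
      by_contra! hk
      exact hn ⟨n - k, by simp [hk]⟩
    simp [Nat.choose_eq_zero_of_lt this]

lemma hasSum_exp (z : ℝ) : HasSum (fun n : ℕ => z ^ n / n.factorial) (Real.exp z) := by
  rw [Real.exp_eq_exp_ℝ]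
  exact NormedSpace.expSeries_div_hasSum_exp z

lemma hasSum_choose_mul_pow_div (c : ℝ) (n : ℕ) (x : ℝ) :
    HasSum (fun k => (n.choose k : ℝ) * (-x) ^ k / pochR c k) (laguerreNormalized c n x) := by
  refine hasSum_sum_of_ne_finset_zero fun k hk => ?_
  rw [Nat.choose_eq_zero_of_lt (by simpa using hk)]; simp

/-- The generating function of the Laguerre polynomials. -/
lemma hasSum_laguerre_generating {c : ℝ} (hc : 0 < c) (x : ℝ) {s : ℝ} (hs : |s| < 1) :
    HasSum (fun n => laguerreWeight c n * laguerreNormalized c n x * s ^ n)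
      (1 / (1 - s) ^ c * Real.exp (-x * (s / (1 - s)))) := by
  have key : ∀ X r : ℝ, |r| < 1 →
      (∀ k, HasSum (fun n => X ^ k / pochR c k * (laguerreWeight c n * (n.choose k : ℝ) * r ^ n))
        (1 / (1 - r) ^ c * ((X * (r / (1 - r))) ^ k / k.factorial))) := by
    intro X r hr k
    refine hasSum_of_eq ((hasSum_laguerreWeight_mul_choose_mul_pow c k hr).mul_left
      (X ^ k / pochR c k)) (fun _ => rfl) ?_
    have := (pochR_pos_s16 hc k).ne'
    unfold laguerreWeight
    rw [mul_pow]
    field_simp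
  have h := (hasSum_swap_of_dominated (fun k n => ?_) (key |x| |s| (by simpa using hs))
    ((hasSum_exp _).summable.mul_left _) (key (-x) s hs) ((hasSum_exp _).mul_left _)).2
  · refine hasSum_of_eq h (fun n => HasSum.tsum_eq ?_) rfl
    exact hasSum_of_eq ((hasSum_choose_mul_pow_div c n x).mul_left (laguerreWeight c n * s ^ n))
      (fun k => by ring) (by ring)
  · simp only [abs_mul, abs_div, abs_pow, abs_neg, Nat.abs_cast, abs_of_pos (pochR_pos_s16 hc k),
      abs_of_pos (laguerreWeight_pos hc n)]
    exact le_rfl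

lemma eq_of_hasSum_mul_pow {a b : ℕ → ℝ} {F : ℝ → ℝ} {δ : ℝ} (hδ : 0 < δ)
    (ha : ∀ h, |h| < δ → HasSum (fun k => a k * h ^ k) (F h))
    (hb : ∀ h, |h| < δ → HasSum (fun k => b k * h ^ k) (F h)) : a = b := by
  have hev : ∀ᶠ h : ℝ in nhds 0, |h| < δ := by
    filter_upwards [Metric.ball_mem_nhds (0 : ℝ) hδ] with h hh
    simpa using hh
  have key : ∀ u : ℕ → ℝ, (∀ h, |h| < δ → HasSum (fun k => u k * h ^ k) (F h)) →
      HasFPowerSeriesAt F (FormalMultilinearSeries.ofScalars ℝ u) 0 := by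
    intro u hu
    rw [hasFPowerSeriesAt_iff]
    filter_upwards [hev] with h hh
    refine hasSum_of_eq (hu h hh) (fun k => ?_) (by simp)
    simp [FormalMultilinearSeries.coeff_ofScalars, mul_comm]
  have h := (key a ha).eq_formalMultilinearSeries (key b hb)
  ext k
  simpa [FormalMultilinearSeries.coeff_ofScalars] using congrArg (fun p => p.coeff k) h

lemma hasSum_choose_mul_pow_mul_pow (n : ℕ) (s h : ℝ) :
    HasSum (fun k => (n.choose k : ℝ) * s ^ (n - k) * h ^ k) ((s + h) ^ n) := by
  rw [add_comm s h, add_pow, Finset.sum_congr rfl fun k _ =>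
    show h ^ k * s ^ (n - k) * (n.choose k : ℝ) = (n.choose k : ℝ) * s ^ (n - k) * h ^ k by ring]
  refine hasSum_sum_of_ne_finset_zero fun k hk => ?_
  rw [Nat.choose_eq_zero_of_lt (by simpa using hk)]; simp

/-- The Taylor coefficients of the Laguerre generating function at a point `s` of the unit disc. -/
lemma hasSum_laguerre_mul_choose {c : ℝ} (hc : 0 < c) (x : ℝ) (k : ℕ) {s : ℝ} (hs : |s| < 1) :
    HasSum (fun n => laguerreWeight c n * laguerreNormalized c n x * (n.choose k : ℝ) * s ^ n)
      (1 / (1 - s) ^ c * Real.exp (-x * (s / (1 - s))) *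
        (laguerreWeight c k * laguerreNormalized c k (x / (1 - s)) * (s / (1 - s)) ^ k)) := by
  have hs1 : 0 < 1 - s := by linarith [(abs_lt.1 hs).2]
  have hδ : 0 < 1 - |s| := by linarith
  set w := laguerreWeight c
  set P := laguerreNormalized c
  have hdom : ∀ h, |h| < 1 - |s| →
      (∀ k, Summable fun n => w n * P n x * ((n.choose k : ℝ) * s ^ (n - k) * h ^ k)) ∧
      HasSum (fun k => ∑' n, w n * P n x * ((n.choose k : ℝ) * s ^ (n - k) * h ^ k))
        (1 / (1 - (s + h)) ^ c * Real.exp (-x * ((s + h) / (1 - (s + h))))) := by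
    intro h hh
    refine hasSum_swap_of_dominated (f := fun n k =>
        w n * P n x * ((n.choose k : ℝ) * s ^ (n - k) * h ^ k))
      (g := fun n k => w n * P n (-|x|) * ((n.choose k : ℝ) * |s| ^ (n - k) * |h| ^ k))
      (fun n k => ?_)
      (fun n => (hasSum_choose_mul_pow_mul_pow n |s| |h|).mul_left _)
      (hasSum_laguerre_generating hc (-|x|) (s := |s| + |h|) ?_).summable
      (fun n => (hasSum_choose_mul_pow_mul_pow n s h).mul_left _)
      (hasSum_laguerre_generating hc x ?_)
    · simp only [abs_mul, abs_pow, Nat.abs_cast]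
      rw [abs_of_pos (laguerreWeight_pos hc n)]
      have := abs_laguerreNormalized_le hc n x
      have := laguerreWeight_pos hc n
      gcongr
    · rw [abs_of_nonneg (by positivity)]; linarith
    · linarith [abs_add_le s h]
  have heq := eq_of_hasSum_mul_pow
    (a := fun k => ∑' n, w n * P n x * ((n.choose k : ℝ) * s ^ (n - k)))
    (b := fun k => 1 / (1 - s) ^ c * Real.exp (-x * (s / (1 - s))) *
      (w k * P k (x / (1 - s)) * (1 / (1 - s)) ^ k)) hδ
    (fun h hh => hasSum_of_eq (hdom h hh).2 (fun k => by
      rw [← tsum_mul_right]; exact tsum_congr fun n => by ring) rfl)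
    (fun h hh => by
      have hh1 : |h| < 1 - s := by linarith [le_abs_self s]
      have h1 : |h / (1 - s)| < 1 := by
        rw [abs_div, abs_of_pos hs1]; exact (div_lt_one hs1).2 hh1
      have h2 : 0 < 1 - (s + h) := by linarith [(abs_lt.1 hh1).2]
      have h3 : 1 - h / (1 - s) = (1 - (s + h)) / (1 - s) := by field_simp; ring
      refine hasSum_of_eq ((hasSum_laguerre_generating hc (x / (1 - s)) h1).mul_left
        (1 / (1 - s) ^ c * Real.exp (-x * (s / (1 - s))))) (fun k => ?_) ?_
      · rw [div_pow, one_div_pow]; ring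
      · rw [h3, Real.div_rpow h2.le hs1.le, mul_mul_mul_comm, ← Real.exp_add]
        have := Real.rpow_pos_of_pos hs1 c
        have := Real.rpow_pos_of_pos h2 c
        congr 1
        · field_simp
        · congr 1
          have := h2.ne'
          field_simp
          ring)
  have hsum : Summable fun n => w n * P n x * ((n.choose k : ℝ) * s ^ (n - k)) := by
    have h0 : (((1 - |s|) / 2) ^ k) ≠ 0 := by positivity
    have h1 := (hdom ((1 - |s|) / 2) (by rw [abs_of_pos (by positivity)]; linarith)).1 k
    rw [← summable_mul_right_iff h0]
    exact h1.congr fun n => by ring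
  refine hasSum_of_eq ((hsum.hasSum.mul_right (s ^ k))) (fun n => ?_) ?_
  · rcases le_or_gt k n with h | h
    · rw [← pow_sub_mul_pow s h]; ring
    · simp [Nat.choose_eq_zero_of_lt h]
  · rw [show (∑' n, w n * P n x * ((n.choose k : ℝ) * s ^ (n - k))) = _ from congrFun heq k]
    simp only [div_pow, one_pow]
    ring

lemma one_le_pochR {c : ℝ} (hc : 1 ≤ c) (k : ℕ) : 1 ≤ pochR c k :=
  Finset.one_le_prod fun j _ => by
    have : (0 : ℝ) ≤ j := by positivity
    linarith

lemma abs_realHyp0F1_term_le {c : ℝ} (hc : 1 ≤ c) (u : ℝ) (k : ℕ) :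
    |u ^ k / (pochR c k * k.factorial)| ≤ |u| ^ k / k.factorial := by
  have h := one_le_pochR hc k
  have h1 : (0 : ℝ) < k.factorial := by positivity
  rw [abs_div, abs_pow, abs_of_pos (by positivity : 0 < pochR c k * k.factorial)]
  gcongr
  nlinarith

lemma continuous_realHyp0F1 {c : ℝ} (hc : 1 ≤ c) : Continuous (realHyp0F1 c) := by
  refine continuous_iff_continuousAt.2 fun u => ?_
  have h : ContinuousOn (realHyp0F1 c) (Metric.ball 0 (|u| + 1)) := by
    refine continuousOn_tsum (u := fun k : ℕ => (|u| + 1) ^ k / k.factorial)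
      (fun k => by fun_prop) (hasSum_exp _).summable fun k v hv => ?_
    have hv' : |v| ≤ |u| + 1 := by simpa using (Metric.mem_ball.1 hv).le
    exact (abs_realHyp0F1_term_le hc v k).trans (by gcongr)
  exact h.continuousAt (Metric.isOpen_ball.mem_nhds (by simp))

lemma hasSum_pow_div_factorial_mul_laguerre {c : ℝ} (hc : 1 ≤ c) (w z : ℝ) :
    HasSum (fun k : ℕ => z ^ k / k.factorial * laguerreNormalized c k w)
      (Real.exp z * realHyp0F1 c (-w * z)) := by
  have h := hasSum_sum_range_mul_of_summable_norm
    (f := fun k : ℕ => (-w * z) ^ k / (pochR c k * k.factorial))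
    (g := fun k : ℕ => z ^ k / k.factorial)
    ((hasSum_exp |(-w * z)|).summable.of_nonneg_of_le (fun _ => norm_nonneg _)
      (abs_realHyp0F1_term_le hc _))
    (by simpa using (hasSum_exp |z|).summable)
  refine hasSum_of_eq h (fun n => ?_) ?_
  · rw [laguerreNormalized, Finset.mul_sum]
    refine Finset.sum_congr rfl fun i hi => ?_
    have hi : i ≤ n := Nat.lt_succ_iff.1 (Finset.mem_range.1 hi)
    have hp := (pochR_pos_s16 (by linarith : 0 < c) i).ne'
    have h1 : (i.factorial : ℝ) ≠ 0 := by positivity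
    have h2 : ((n - i).factorial : ℝ) ≠ 0 := by positivity
    have h3 : (n.factorial : ℝ) ≠ 0 := by positivity
    rw [Nat.cast_choose ℝ hi, mul_pow, ← Nat.sub_add_cancel hi, pow_add z, Nat.sub_add_cancel hi]
    field_simp
  · rw [(hasSum_exp z).tsum_eq, mul_comm]; rfl

/-- The **Hardy–Hille formula**. -/
lemma hasSum_laguerre_mul_laguerre {c : ℝ} (hc : 1 ≤ c) (x y : ℝ) {s : ℝ} (hs : |s| < 1) :
    HasSum (fun n => laguerreWeight c n * laguerreNormalized c n x * laguerreNormalized c n y * s ^ n)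
      (1 / (1 - s) ^ c * Real.exp (-x * (s / (1 - s))) *
        (Real.exp (-y * (s / (1 - s))) *
          realHyp0F1 c (-(x / (1 - s)) * (-y * (s / (1 - s)))))) := by
  have hc0 : 0 < c := by linarith
  have row : ∀ X Y r : ℝ, |r| < 1 → ∀ k,
      HasSum (fun n => Y ^ k / pochR c k *
        (laguerreWeight c n * laguerreNormalized c n X * (n.choose k : ℝ) * r ^ n))
        (1 / (1 - r) ^ c * Real.exp (-X * (r / (1 - r))) *
          ((Y * (r / (1 - r))) ^ k / k.factorial * laguerreNormalized c k (X / (1 - r)))) := by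
    intro X Y r hr k
    refine hasSum_of_eq ((hasSum_laguerre_mul_choose hc0 X k hr).mul_left (Y ^ k / pochR c k))
      (fun _ => rfl) ?_
    have := (pochR_pos_s16 hc0 k).ne'
    unfold laguerreWeight
    rw [mul_pow]
    field_simp
  have h := (hasSum_swap_of_dominated (fun k n => ?_) (row (-|x|) |y| |s| (by simpa using hs))
    ((hasSum_pow_div_factorial_mul_laguerre hc _ _).summable.mul_left _) (row x (-y) s hs)
    ((hasSum_pow_div_factorial_mul_laguerre hc _ _).mul_left _)).2
  · refine hasSum_of_eq h (fun n => HasSum.tsum_eq ?_) rfl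
    exact hasSum_of_eq ((hasSum_choose_mul_pow_div c n y).mul_left
      (laguerreWeight c n * laguerreNormalized c n x * s ^ n)) (fun k => by ring) (by ring)
  · have h1 := pochR_pos_s16 hc0 k
    have h2 := laguerreWeight_pos hc0 n
    have h3 := abs_laguerreNormalized_le hc0 n x
    simp only [abs_mul, abs_div, abs_pow, abs_neg, Nat.abs_cast, abs_of_pos h1, abs_of_pos h2]
    gcongr

lemma ofReal_realHyp0F1 (c u : ℝ) : ((realHyp0F1 c u : ℝ) : ℂ) = hyp0F1 c u := by
  simp [realHyp0F1, hyp0F1, ← ofReal_pochR, Complex.ofReal_tsum]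

lemma betaOdd_eq_s16 (a x : ℝ) (n : ℕ) :
    betaOdd a x n = (((-1) ^ n * Real.sqrt (laguerreWeight (a + 1) n) * calB1 a x *
      laguerreNormalized (a + 1) n (x ^ 2) : ℝ) : ℂ) := by
  simp [betaOdd, laguerreNormalized_eq, laguerreWeight, ofReal_pochR, pow_mul]

lemma epsOdd_eq (a E : ℝ) (n : ℕ) :
    epsOdd a E n = Real.sqrt (laguerreWeight (a + 1) n) * calE1 a E *
      laguerreNormalized (a + 1) n (2 * E) := by
  simp [epsOdd, laguerreNormalized_eq, laguerreWeight]

lemma calB1_mul_calE1 {a : ℝ} (ha : 0 < a) (E x : ℝ) :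
    calB1 a x * calE1 a E * (1 / 2 ^ (a + 1) * Real.exp (x ^ 2 / 2) * Real.exp E) =
      1 / ((2 : ℝ) ^ ((a + 1) / 2) * Real.Gamma (a + 1)) * (x * |x| ^ (a - 1 / 2)) *
        E ^ (a / 2) := by
  have hG : 0 < Real.Gamma (a + 1) := Real.Gamma_pos_of_pos (by linarith)
  have h2 : (0 : ℝ) < 2 ^ ((a + 1) / 2) := by positivity
  have h3 : (2 : ℝ) ^ (a + 1) = 2 ^ ((a + 1) / 2) * 2 ^ ((a + 1) / 2) := by
    rw [← Real.rpow_add two_pos]; ring_nf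
  have h4 : Real.exp (-x ^ 2 / 2) * Real.exp (x ^ 2 / 2) = 1 := by
    rw [← Real.exp_add]; ring_nf; simp
  have h5 : Real.exp (-E) * Real.exp E = 1 := by rw [← Real.exp_add]; simp
  have h6 := Real.mul_self_sqrt hG.le
  have h7 : Real.sqrt (Real.Gamma (a + 1)) ≠ 0 := (Real.sqrt_pos.2 hG).ne'
  unfold calB1 calE1
  rw [h3, Real.sqrt_mul_self h2.le]
  calc _ = (Real.exp (-x ^ 2 / 2) * Real.exp (x ^ 2 / 2)) * (Real.exp (-E) * Real.exp E) *
        (x * |x| ^ (a - 1 / 2)) * E ^ (a / 2) / (2 ^ ((a + 1) / 2) *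
          (Real.sqrt (Real.Gamma (a + 1)) * Real.sqrt (Real.Gamma (a + 1)))) := by
        field_simp
    _ = _ := by
        rw [h4, h5, h6]; field_simp

/-- the Abel limit of the overlap series between the position eigenvector
and the odd free-particle energy eigenvector exists and equals
`(1/(2^{(a+1)/2}·Γ(a+1))) · x·|x|^{a−1/2} · E^{a/2} · ₀F₁(−; a+1; −E·x²/2)`. -/
theorem abel_limit_position_odd_free (a E x : ℝ) (ha : 0 < a) (hE : 0 < E) (hx : x ≠ 0) :
    Filter.Tendsto
      (fun t : ℝ => ∑' n : ℕ, betaOdd a x n * (epsOdd a E n : ℂ) * (t : ℂ) ^ n)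
      (nhdsWithin 1 (Set.Iio 1))
      (nhds
        ((1 / (((2 : ℝ) ^ ((a + 1) / 2) * Real.Gamma (a + 1) : ℝ) : ℂ)) *
          ((x : ℂ) * ((|x| ^ (a - 1 / 2) : ℝ) : ℂ)) * ((E ^ (a / 2) : ℝ) : ℂ) *
          hyp0F1 ((a : ℂ) + 1) (-(E : ℂ) * (x : ℂ) ^ 2 / 2))) := by
  have hc : 1 ≤ a + 1 := by linarith
  have hsum : ∀ t : ℝ, |t| < 1 →
      ∑' n : ℕ, betaOdd a x n * (epsOdd a E n : ℂ) * (t : ℂ) ^ n =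
        ((calB1 a x * calE1 a E * (1 / (1 - -t) ^ (a + 1) *
          Real.exp (-(x ^ 2) * (-t / (1 - -t))) * (Real.exp (-(2 * E) * (-t / (1 - -t))) *
          realHyp0F1 (a + 1) (-(x ^ 2 / (1 - -t)) * (-(2 * E) * (-t / (1 - -t)))))) : ℝ) : ℂ) := by
    intro t ht
    have h := ((hasSum_laguerre_mul_laguerre hc (x ^ 2) (2 * E) (s := -t)
      (by simpa using ht)).mul_left (calB1 a x * calE1 a E)).tsum_eq
    rw [← h, Complex.ofReal_tsum]
    refine tsum_congr fun n => ?_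
    rw [betaOdd_eq_s16, epsOdd_eq, ← Complex.ofReal_pow, ← Complex.ofReal_mul, ← Complex.ofReal_mul,
      neg_pow t]
    congr 1
    have hw := Real.mul_self_sqrt (laguerreWeight_pos (by linarith : 0 < a + 1) n).le
    nth_rw 3 [← hw]
    ring
  have hlim : ((1 / (((2 : ℝ) ^ ((a + 1) / 2) * Real.Gamma (a + 1) : ℝ) : ℂ)) *
      ((x : ℂ) * ((|x| ^ (a - 1 / 2) : ℝ) : ℂ)) * ((E ^ (a / 2) : ℝ) : ℂ) *
      hyp0F1 ((a : ℂ) + 1) (-(E : ℂ) * (x : ℂ) ^ 2 / 2)) =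
      ((calB1 a x * calE1 a E * (1 / (1 - -1) ^ (a + 1) *
          Real.exp (-(x ^ 2) * (-1 / (1 - -1))) * (Real.exp (-(2 * E) * (-1 / (1 - -1))) *
          realHyp0F1 (a + 1) (-(x ^ 2 / (1 - -1)) * (-(2 * E) * (-1 / (1 - -1)))))) : ℝ) : ℂ) := by
    have h1 : hyp0F1 ((a : ℂ) + 1) (-(E : ℂ) * (x : ℂ) ^ 2 / 2) =
        ((realHyp0F1 (a + 1) (-E * x ^ 2 / 2) : ℝ) : ℂ) := by
      rw [ofReal_realHyp0F1]; push_cast; rfl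
    rw [h1, show (1 - -1 : ℝ) = 2 by norm_num,
      show -(x ^ 2) * (-1 / 2) = x ^ 2 / 2 by ring, show -(2 * E) * (-1 / 2) = E by ring,
      show -(x ^ 2 / 2) * E = -E * x ^ 2 / 2 by ring, ← mul_assoc (1 / _ * _ : ℝ),
      ← mul_assoc (calB1 a x * calE1 a E), calB1_mul_calE1 ha]
    push_cast
    rfl
  rw [hlim]
  refine Filter.Tendsto.congr' (f₁ := fun t : ℝ =>
    ((calB1 a x * calE1 a E * (1 / (1 - -t) ^ (a + 1) *
      Real.exp (-(x ^ 2) * (-t / (1 - -t))) * (Real.exp (-(2 * E) * (-t / (1 - -t))) *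
      realHyp0F1 (a + 1) (-(x ^ 2 / (1 - -t)) * (-(2 * E) * (-t / (1 - -t)))))) : ℝ) : ℂ)) ?_ ?_
  · filter_upwards [Ioo_mem_nhdsLT (show (0 : ℝ) < 1 by norm_num)] with t ht
    exact (hsum t (by rw [abs_of_pos ht.1]; exact ht.2)).symm
  · refine Filter.Tendsto.mono_left ?_ nhdsWithin_le_nhds
    refine ContinuousAt.tendsto (f := fun t : ℝ => ((calB1 a x * calE1 a E * _ : ℝ) : ℂ)) ?_
    have hF := continuous_realHyp0F1 hc
    have h0 : (1 - -1 : ℝ) ≠ 0 := by norm_num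
    have h1 : ContinuousAt (fun t : ℝ => -t / (1 - -t)) 1 :=
      ContinuousAt.div (by fun_prop) (by fun_prop) h0
    have h2 : ContinuousAt (fun t : ℝ => x ^ 2 / (1 - -t)) 1 :=
      ContinuousAt.div (by fun_prop) (by fun_prop) h0
    have h3 : ContinuousAt (fun t : ℝ => 1 / (1 - -t) ^ (a + 1)) 1 :=
      ContinuousAt.div (by fun_prop)
        (ContinuousAt.rpow_const (by fun_prop) (Or.inl h0)) (by positivity)
    fun_prop
end
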